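/- For the periodic split-form semidiscretization of the 2D shallow water equations with variable bathymetry (the λ = 0 case of the hyperbolic Serre–Green–Naghdi semidiscretization): if D_x and D_y are periodic first-derivative SBP operators with common diagonal positive-definite mass matrix M, and the differentiable time-dependent grid functions h, u, v satisfy the shallow water semidiscretization for all t, then the total discrete energy 𝟏ᵀ M E_SW(t), with E_SW = (g/2) h² + g h∘b + (1/2) h∘(u² + v²), is constant in time, i.e., its time derivative vanishes at every time t. -/

import Mathlib

open Matrix

lemma one_dotProduct_mulVec_of_isDiag {ι : Type*} [Fintype ι] [DecidableEq ι]
    {M : Matrix ι ι ℝ} (hM : M.IsDiag) (w : ι → ℝ) :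
    (1 : ι → ℝ) ⬝ᵥ (M *ᵥ w) = ∑ i, M i i * w i := by
  conv_lhs => rw [← hM.diagonal_diag]
  simp [dotProduct, mulVec_diagonal]

/-- A periodic SBP operator is skew-symmetric with respect to its diagonal mass matrix. -/
lemma sum_mul_mulVec_add_mul_mulVec_eq_zero {ι : Type*} [Fintype ι] [DecidableEq ι]
    {M D : Matrix ι ι ℝ} (hM : M.IsDiag) (hD : M * D + Dᵀ * M = 0) (a c : ι → ℝ) :
    ∑ i, M i i * (a i * (D *ᵥ c) i + c i * (D *ᵥ a) i) = 0 := by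
  have hentry (i j : ι) : M i i * D i j + D j i * M j j = 0 := by
    have key := congrFun (congrFun hD i) j
    rw [← hM.diagonal_diag] at key
    simpa using key
  have hswap : ∑ i, M i i * (c i * (D *ᵥ a) i) = ∑ i, ∑ j, M j j * (c j * (D j i * a i)) := by
    rw [Finset.sum_comm]
    simp only [mulVec, dotProduct, Finset.mul_sum]
  simp only [mul_add, Finset.sum_add_distrib]
  rw [hswap, ← Finset.sum_add_distrib]
  refine Finset.sum_eq_zero fun i _ => ?_
  simp only [mulVec, dotProduct, Finset.mul_sum]
  rw [← Finset.sum_add_distrib]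
  refine Finset.sum_eq_zero fun j _ => ?_
  linear_combination a i * c j * hentry i j

theorem periodic_shallow_water_energy_conservation
    {ι : Type*} [Fintype ι] [DecidableEq ι] [Nonempty ι]
    (M Dx Dy : Matrix ι ι ℝ)
    (hMdiag : M.IsDiag) (hMpd : M.PosDef)
    (hSBPx : M * Dx + Dxᵀ * M = 0) (hSBPy : M * Dy + Dyᵀ * M = 0)
    (g : ℝ) (hg : 0 < g) (b : ι → ℝ)
    (h u v h' u' v' : ℝ → ι → ℝ)
    (hdh : ∀ (t : ℝ) (i : ι), HasDerivAt (fun s => h s i) (h' t i) t)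
    (hdu : ∀ (t : ℝ) (i : ι), HasDerivAt (fun s => u s i) (u' t i) t)
    (hdv : ∀ (t : ℝ) (i : ι), HasDerivAt (fun s => v s i) (v' t i) t)
    (heqh : ∀ t : ℝ, h' t = -(u t * (Dx *ᵥ h t) + h t * (Dx *ᵥ u t) + v t * (Dy *ᵥ h t) + h t * (Dy *ᵥ v t)))
    (hequ : ∀ t : ℝ, h t * u' t = -(g • (Dx *ᵥ (h t * (h t + b))) - g • ((h t + b) * (Dx *ᵥ h t)) + (1/2 : ℝ) • (h t * (Dx *ᵥ (u t^2))) - (1/2 : ℝ) • (u t^2 * (Dx *ᵥ h t)) + (1/2 : ℝ) • (u t * (Dx *ᵥ (h t * u t))) - (1/2 : ℝ) • (h t * u t * (Dx *ᵥ u t)) + (1/2 : ℝ) • (Dy *ᵥ (h t * u t * v t)) - (1/2 : ℝ) • (u t * v t * (Dy *ᵥ h t)) + (1/2 : ℝ) • (h t * v t * (Dy *ᵥ u t)) - (1/2 : ℝ) • (h t * u t * (Dy *ᵥ v t))))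
    (heqv : ∀ t : ℝ, h t * v' t = -(g • (Dy *ᵥ (h t * (h t + b))) - g • ((h t + b) * (Dy *ᵥ h t)) + (1/2 : ℝ) • (h t * (Dy *ᵥ (v t^2))) - (1/2 : ℝ) • (v t^2 * (Dy *ᵥ h t)) + (1/2 : ℝ) • (v t * (Dy *ᵥ (h t * v t))) - (1/2 : ℝ) • (h t * v t * (Dy *ᵥ v t)) + (1/2 : ℝ) • (Dx *ᵥ (h t * u t * v t)) - (1/2 : ℝ) • (u t * v t * (Dx *ᵥ h t)) + (1/2 : ℝ) • (h t * u t * (Dx *ᵥ v t)) - (1/2 : ℝ) • (h t * v t * (Dx *ᵥ u t)))) :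
    ∀ t : ℝ, HasDerivAt (fun s => (1 : ι → ℝ) ⬝ᵥ (M *ᵥ ((g/2) • (h s^2) + g • (h s * b) + (1/2 : ℝ) • (h s * (u s^2 + v s^2))))) 0 t := by
  intro t
  simp only [one_dotProduct_mulVec_of_isDiag hMdiag]
  have hderiv : HasDerivAt
      (fun s => ∑ i, M i i *
        ((g/2) • (h s^2) + g • (h s * b) + (1/2 : ℝ) • (h s * (u s^2 + v s^2))) i)
      (∑ i, M i i * ((g * (h t i + b i) + 1/2 * (u t i ^ 2 + v t i ^ 2)) * h' t i
        + u t i * (h t i * u' t i) + v t i * (h t i * v' t i))) t := by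
    refine HasDerivAt.fun_sum fun i _ => ?_
    have e := ((((hdh t i).pow 2).const_mul (g/2)).add
      (((hdh t i).mul_const (b i)).const_mul g)).add
      (((hdh t i).mul (((hdu t i).pow 2).add ((hdv t i).pow 2))).const_mul (1/2 : ℝ))
    refine (e.const_mul (M i i)).congr_deriv ?_
    simp only [Pi.add_apply, Pi.pow_apply]
    push_cast
    ring
  refine hderiv.congr_deriv ?_
  have sx := sum_mul_mulVec_add_mul_mulVec_eq_zero hMdiag hSBPx
  have sy := sum_mul_mulVec_add_mul_mulVec_eq_zero hMdiag hSBPy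
  have flux_x := congrArg (g * ·) (sx (h t * (h t + b)) (u t))
  have flux_y := congrArg (g * ·) (sy (h t * (h t + b)) (v t))
  have kin_xu := congrArg ((1/2 : ℝ) * ·) (sx (h t * u t) (u t ^ 2))
  have kin_xv := congrArg ((1/2 : ℝ) * ·) (sx (h t * u t * v t) (v t))
  have kin_yv := congrArg ((1/2 : ℝ) * ·) (sy (h t * v t) (v t ^ 2))
  have kin_yu := congrArg ((1/2 : ℝ) * ·) (sy (h t * u t * v t) (u t))
  simp only [mul_zero, Finset.mul_sum] at flux_x flux_y kin_xu kin_xv kin_yv kin_yu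
  have total := congrArg₂ (· + ·) (congrArg₂ (· + ·) flux_x flux_y)
    (congrArg₂ (· + ·) (congrArg₂ (· + ·) kin_xu kin_xv) (congrArg₂ (· + ·) kin_yv kin_yu))
  simp only [← Finset.sum_add_distrib, add_zero] at total
  rw [← neg_eq_zero, ← Finset.sum_neg_distrib, ← total]
  refine Finset.sum_congr rfl fun i _ => ?_
  have eh := congrFun (heqh t) i
  have eu := congrFun (hequ t) i
  have ev := congrFun (heqv t) i
  simp only [Pi.add_apply, Pi.sub_apply, Pi.mul_apply, Pi.neg_apply, Pi.smul_apply, Pi.pow_apply,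
    smul_eq_mul] at eh eu ev ⊢
  linear_combination -(M i i) * ((g * (h t i + b i) + 1/2 * (u t i ^ 2 + v t i ^ 2)) * eh
    + u t i * eu + v t i * ev)
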